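/- Let N, M ≥ 2, let q ∈ ℂ with 0 < |q| < 1, and let a_1,…,a_M, b_1,…,b_N, x_1,…,x_M ∈ ℂ, γ_1,…,γ_N ∈ ℂ, with b_j ∉ q^ℤ, and x_i ∉ q^ℤ, a_i x_i ∉ q^ℤ for all i (also after replacing x_M by q x_M). Set ν_j = γ_j − γ_{j+1} (γ_{N+1} = 0). For parameters (a⃗, x⃗) and n ∈ ℤ^N put u_j = q^{n_j} (u_0 = 1), Φ(n; a⃗, x⃗) = ∏_{j=1}^N u_j^{ν_j} (q u_j/u_{j−1};q)_∞/(b_j u_j/u_{j−1};q)_∞ · ∏_{i=1}^M (a_i x_i u_N;q)_∞/(x_i u_N;q)_∞, p_{j,i}(n; a⃗, x⃗) = (u_{j−1} − b_j u_j)/(1 − a_i x_i u_N) · ∏_{k=1}^{i−1} (1 − x_k u_N)/(1 − a_k x_k u_N), and Ψ_{j,i}(a⃗, x⃗) = Σ_{n ∈ ℤ^N} Φ(n; a⃗, x⃗) p_{j,i}(n; a⃗, x⃗), assuming absolute summability. Then for all 1 ≤ j ≤ N and 1 ≤ i ≤ M−1: Ψ_{j,i}(a⃗, (x_1,…,x_{M−1},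 q x_M)) = Ψ_{j,i+1}((a_M, a_1, …, a_{M−1}), (x_M, x_1, …, x_{M−1})), i.e. the q-shift in x_M of Ψ_{j,i} equals Ψ_{j,i+1} with the parameter lists (a_i) and (x_i) cyclically permuted so that the M-th pair moves to the first slot. -/

import Mathlib

noncomputable def qPochInf (q a : ℂ) : ℂ := ∏' i : ℕ, (1 - q ^ i * a)

/-- The exponent of `u_{j-1}`: `n_{j-1}`, with the convention `u_0 = q^0 = 1`. -/
def nprev {N : ℕ} (n : Fin N → ℤ) (j : Fin N) : ℤ :=
  if h : 0 < (j : ℕ) then n ⟨(j : ℕ) - 1, Nat.lt_of_le_of_lt (Nat.sub_le _ _) j.isLt⟩ else 0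

/-- The exponent of `u_N = q^{n_N}` (the last coordinate). -/
def nlast {N : ℕ} (n : Fin N → ℤ) : ℤ :=
  if h : 0 < N then n ⟨N - 1, Nat.sub_lt h one_pos⟩ else 0

/-- `ν_j = γ_j − γ_{j+1}` with `γ_{N+1} = 0`. -/
def nuOf {N : ℕ} (γ : Fin N → ℂ) (j : Fin N) : ℂ :=
  γ j - if h : (j : ℕ) + 1 < N then γ ⟨(j : ℕ) + 1, h⟩ else 0

/-- The integrand `Φ(n) = ∏_j u_j^{ν_j} (q u_j/u_{j−1};q)_∞/(b_j u_j/u_{j−1};q)_∞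
· ∏_i (a_i x_i u_N;q)_∞/(x_i u_N;q)_∞` evaluated at `u_j = q^{n_j}`, with
`u_j^{ν_j} = exp(ν_j n_j Log q)`. -/
noncomputable def PhiInt (q : ℂ) {N M : ℕ} (γ b : Fin N → ℂ) (a x : Fin M → ℂ)
    (n : Fin N → ℤ) : ℂ :=
  (∏ j : Fin N, Complex.exp (nuOf γ j * (n j : ℂ) * Complex.log q) *
      (qPochInf q (q ^ (n j - nprev n j + 1)) /
        qPochInf q (b j * q ^ (n j - nprev n j)))) *
  ∏ i : Fin M, qPochInf q (a i * x i * q ^ nlast n) / qPochInf q (x i * q ^ nlast n)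

/-- `p_{j,i}(n) = (u_{j−1} − b_j u_j)/(1 − a_i x_i u_N) ·
∏_{k<i} (1 − x_k u_N)/(1 − a_k x_k u_N)` at `u_j = q^{n_j}`. -/
noncomputable def pInt (q : ℂ) {N M : ℕ} (b : Fin N → ℂ) (a x : Fin M → ℂ)
    (j : Fin N) (i : Fin M) (n : Fin N → ℤ) : ℂ :=
  (q ^ nprev n j - b j * q ^ n j) / (1 - a i * x i * q ^ nlast n) *
  ∏ k ∈ Finset.Iio i, (1 - x k * q ^ nlast n) / (1 - a k * x k * q ^ nlast n)

/-- `Ψ_{j,i} = Σ_{n ∈ ℤ^N} Φ(n) p_{j,i}(n)` (bilateral Jackson sum). -/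
noncomputable def PsiJI (q : ℂ) {N M : ℕ} (γ b : Fin N → ℂ) (a x : Fin M → ℂ)
    (j : Fin N) (i : Fin M) : ℂ :=
  ∑' n : Fin N → ℤ, PhiInt q γ b a x n * pInt q b a x j i n

/-- Cyclic rotation of a parameter list moving the last entry to the first
slot: `(a_1,…,a_M) ↦ (a_M, a_1, …, a_{M−1})` (0-based: `k ↦ a_{k−1 mod M}`). -/
def rotLast {M : ℕ} (a : Fin M → ℂ) : Fin M → ℂ := fun k =>
  if h : 0 < (k : ℕ) then a ⟨(k : ℕ) - 1, Nat.lt_of_le_of_lt (Nat.sub_le _ _) k.isLt⟩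
  else a ⟨M - 1, Nat.sub_lt k.pos one_pos⟩

theorem multipliable_one_sub_pow_mul {q : ℂ} (hq : ‖q‖ < 1) (a : ℂ) :
    Multipliable fun i : ℕ => 1 - q ^ i * a := by
  have h : Summable fun i : ℕ => ‖-(q ^ i * a)‖ := by
    simpa only [norm_neg, norm_mul, norm_pow] using
      (summable_geometric_of_lt_one (norm_nonneg q) hq).mul_right ‖a‖
  simpa only [sub_eq_add_neg] using multipliable_one_add_of_summable h

theorem qPochInf_eq_one_sub_mul {q : ℂ} (hq : ‖q‖ < 1) (a : ℂ) :
    qPochInf q a = (1 - a) * qPochInf q (q * a) := by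
  have h : ∀ i : ℕ, 1 - q ^ (i + 1) * a = 1 - q ^ i * (q * a) := fun i => by ring
  unfold qPochInf
  rw [tprod_eq_zero_mul']
  · simp only [h, pow_zero, one_mul]
  · simpa only [h] using multipliable_one_sub_pow_mul hq (q * a)

theorem rotLast_zero {m : ℕ} (a : Fin (m + 1) → ℂ) : rotLast a 0 = a (Fin.last m) := rfl

theorem rotLast_succ {m : ℕ} (a : Fin (m + 1) → ℂ) (k : Fin m) :
    rotLast a k.succ = a k.castSucc := rfl

theorem prod_Iio_eq_prod_ite {n : ℕ} (f : Fin n → ℂ) (i : Fin n) :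
    ∏ k ∈ Finset.Iio i, f k = ∏ k, if k < i then f k else 1 := by
  rw [← Finset.prod_filter]; congr 1; ext; simp

theorem prod_Iio_succ {m : ℕ} (f : Fin (m + 1) → ℂ) (i : Fin m) :
    ∏ k ∈ Finset.Iio i.succ, f k = f 0 * ∏ k ∈ Finset.Iio i, f k.succ := by
  rw [prod_Iio_eq_prod_ite, prod_Iio_eq_prod_ite, Fin.prod_univ_succ]
  simp

theorem prod_Iio_castSucc {m : ℕ} (f : Fin (m + 1) → ℂ) (i : Fin m) :
    ∏ k ∈ Finset.Iio i.castSucc, f k = ∏ k ∈ Finset.Iio i, f k.castSucc := by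
  rw [prod_Iio_eq_prod_ite, prod_Iio_eq_prod_ite, Fin.prod_univ_castSucc]
  simp [Fin.not_lt.mpr (Fin.le_last _)]

theorem one_sub_mul_zpow_ne_zero {q y : ℂ} (hy : ∀ m : ℤ, y ≠ q ^ m) (m : ℤ) :
    1 - y * q ^ m ≠ 0 := by
  intro h
  apply hy (-m)
  rw [zpow_neg]
  exact eq_inv_of_mul_eq_one_left (sub_eq_zero.mp h).symm

/-- The shift `x_M ↦ q x_M` acts on each summand as the cyclic rotation of the parameters. -/
theorem PhiInt_mul_pInt_update_last {N m : ℕ} {q : ℂ} (hq : ‖q‖ < 1)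
    (γ b : Fin N → ℂ) (a x : Fin (m + 1) → ℂ)
    (hx : ∀ k : ℤ, x (Fin.last m) ≠ q ^ k)
    (hax : ∀ k : ℤ, a (Fin.last m) * x (Fin.last m) ≠ q ^ k)
    (j : Fin N) (i : Fin m) (n : Fin N → ℤ) :
    PhiInt q γ b a (Function.update x (Fin.last m) (q * x (Fin.last m))) n *
        pInt q b a (Function.update x (Fin.last m) (q * x (Fin.last m))) j i.castSucc n =
      PhiInt q γ b (rotLast a) (rotLast x) n *
        pInt q b (rotLast a) (rotLast x) j i.succ n := by
  have h1 := one_sub_mul_zpow_ne_zero hx (nlast n)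
  have h2 := one_sub_mul_zpow_ne_zero hax (nlast n)
  have hu (k : Fin m) : Function.update x (Fin.last m) (q * x (Fin.last m)) k.castSucc =
      x k.castSucc := Function.update_of_ne (Fin.castSucc_lt_last k).ne _ _
  unfold PhiInt pInt
  rw [Fin.prod_univ_castSucc (n := m), Fin.prod_univ_succ (n := m), prod_Iio_castSucc,
    prod_Iio_succ]
  simp only [rotLast_zero, rotLast_succ, hu, Function.update_self]
  rw [qPochInf_eq_one_sub_mul hq (a (Fin.last m) * x (Fin.last m) * q ^ nlast n),
    qPochInf_eq_one_sub_mul hq (x (Fin.last m) * q ^ nlast n),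
    show a (Fin.last m) * (q * x (Fin.last m)) * q ^ nlast n =
      q * (a (Fin.last m) * x (Fin.last m) * q ^ nlast n) by ring,
    mul_assoc q (x (Fin.last m))]
  generalize a (Fin.last m) * x (Fin.last m) * q ^ nlast n = s at *
  generalize x (Fin.last m) * q ^ nlast n = t at *
  rw [mul_div_mul_comm]
  have h3 : (1 - s) / (1 - t) * ((1 - t) / (1 - s)) = 1 := by field_simp
  generalize (1 - s) / (1 - t) = c at *
  generalize (1 - t) / (1 - s) = d at *
  generalize qPochInf q (q * s) / qPochInf q (q * t) = e
  rw [← mul_one (_ * _ * (_ * _)), ← h3]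
  ring

/-- the relation `T_{x_M}(Ψ_{j,i}) = ρ(Ψ_{j,i+1})`: the q-shift
`x_M ↦ q x_M` of `Ψ_{j,i}` equals `Ψ_{j,i+1}` with the parameter lists `a` and
`x` cyclically permuted so that the `M`-th pair moves to the first slot.
Here `Mi` denotes the last index (so `x Mi = x_M`) and `(i1 : ℕ) = i + 1`. -/
theorem stmt13 (N M : ℕ) (hN : 2 ≤ N) (hM : 2 ≤ M) (q : ℂ)
    (hq0 : 0 < ‖q‖) (hq1 : ‖q‖ < 1)
    (a x : Fin M → ℂ) (b γ : Fin N → ℂ)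
    (Mi : Fin M) (hMi : (Mi : ℕ) + 1 = M)
    (hb : ∀ j : Fin N, ∀ m : ℤ, b j ≠ q ^ m)
    (hx : ∀ i : Fin M, ∀ m : ℤ, x i ≠ q ^ m)
    (hax : ∀ i : Fin M, ∀ m : ℤ, a i * x i ≠ q ^ m)
    (hx' : ∀ i : Fin M, ∀ m : ℤ, Function.update x Mi (q * x Mi) i ≠ q ^ m)
    (hax' : ∀ i : Fin M, ∀ m : ℤ, a i * Function.update x Mi (q * x Mi) i ≠ q ^ m)
    (j : Fin N) (i i1 : Fin M) (hi1 : (i1 : ℕ) = (i : ℕ) + 1)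
    (hsum : Summable (fun n : Fin N → ℤ =>
      PhiInt q γ b a (Function.update x Mi (q * x Mi)) n *
        pInt q b a (Function.update x Mi (q * x Mi)) j i n))
    (hsum' : Summable (fun n : Fin N → ℤ =>
      PhiInt q γ b (rotLast a) (rotLast x) n * pInt q b (rotLast a) (rotLast x) j i1 n)) :
    PsiJI q γ b a (Function.update x Mi (q * x Mi)) j i =
      PsiJI q γ b (rotLast a) (rotLast x) j i1 := by
  obtain ⟨m, rfl⟩ : ∃ m, M = m + 1 := ⟨Mi, hMi.symm⟩
  obtain rfl : Mi = Fin.last m := Fin.ext (by simpa using hMi)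
  have him : (i : ℕ) < m := by omega
  obtain ⟨k, rfl⟩ : ∃ k : Fin m, i = k.castSucc := ⟨⟨i, him⟩, rfl⟩
  obtain rfl : i1 = k.succ := Fin.ext hi1
  exact tsum_congr fun n => PhiInt_mul_pInt_update_last hq1 γ b a x (hx _) (hax _) j _ n
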